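/- The only Lucas numbers that are concatenations of two repdigits are 11, 18, 29, 47, 76, 199, and 322. -/

import Mathlib

def lucas : ℕ → ℕ
  | 0 => 2
  | 1 => 1
  | n + 2 => lucas (n + 1) + lucas n

/-- The repunit `11…1` with `k` digits. -/
def repunit : ℕ → ℕ
  | 0 => 0
  | k + 1 => 10 * repunit k + 1

theorem nine_mul_repunit_add_one (k : ℕ) : 9 * repunit k + 1 = 10 ^ k := by
  induction k with
  | zero => rfl
  | succ k ih => rw [repunit, pow_succ, ← ih]; ring

theorem repunit_add (j k : ℕ) : repunit (j + k) = 10 ^ j * repunit k + repunit j := by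
  have h := nine_mul_repunit_add_one (j + k)
  rw [pow_add, ← nine_mul_repunit_add_one k] at h
  have hj := nine_mul_repunit_add_one j
  linarith

theorem concat_repdigits_eq {N d₁ d₂ : ℤ} {l m : ℕ}
    (h : 9 * N = d₁ * (10 ^ l - 1) * 10 ^ m + d₂ * (10 ^ m - 1)) :
    N = d₁ * repunit l * 10 ^ m + d₂ * repunit m := by
  have hl : (9 * repunit l + 1 : ℤ) = 10 ^ l := mod_cast nine_mul_repunit_add_one l
  have hm : (9 * repunit m + 1 : ℤ) = 10 ^ m := mod_cast nine_mul_repunit_add_one m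
  rw [← hl, ← hm] at h
  rw [← hm]
  linarith

theorem lucas_modEq_mod {M P : ℕ} (h₀ : lucas P ≡ lucas 0 [MOD M])
    (h₁ : lucas (P + 1) ≡ lucas 1 [MOD M]) (n : ℕ) : lucas n ≡ lucas (n % P) [MOD M] := by
  have step (n : ℕ) : lucas (n + P) ≡ lucas n [MOD M] := by
    induction n using Nat.twoStepInduction with
    | zero => simpa using h₀
    | one => simpa [add_comm] using h₁
    | more n ih₀ ih₁ =>
      rw [show n + 2 + P = (n + P) + 2 by ring, lucas, lucas,
        show n + P + 1 = n + 1 + P by ring]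
      exact ih₁.add ih₀
  have steps (k r : ℕ) : lucas (r + P * k) ≡ lucas r [MOD M] := by
    induction k with
    | zero => exact Nat.ModEq.refl _
    | succ k ih => rw [mul_add_one, ← add_assoc]; exact (step _).trans ih
  simpa [Nat.mod_add_div] using steps (n / P) (n % P)

theorem repunit_modEq_mod {M Q j : ℕ} (h : repunit (j + Q) ≡ repunit j [MOD M]) (k : ℕ) :
    repunit (j + k) ≡ repunit (j + k % Q) [MOD M] := by
  have step (k : ℕ) : repunit (j + k + Q) ≡ repunit (j + k) [MOD M] := by
    induction k with
    | zero => exact h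
    | succ k ih =>
      rw [show j + (k + 1) + Q = j + k + Q + 1 by ring, ← add_assoc, repunit, repunit]
      exact (ih.mul_left 10).add_right 1
  have steps (i r : ℕ) : repunit (j + r + Q * i) ≡ repunit (j + r) [MOD M] := by
    induction i with
    | zero => exact Nat.ModEq.refl _
    | succ i ih =>
      rw [mul_add_one, show j + r + (Q * i + Q) = j + (r + Q * i) + Q by ring]
      exact (step _).trans (by rwa [← add_assoc])
  have := steps (k / Q) (k % Q)
  rwa [add_assoc, Nat.mod_add_div] at this

theorem lucas_lt_lucas {m n : ℕ} (hm : 1 ≤ m) (h : m < n) : lucas m < lucas n := by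
  have pos (n : ℕ) : 0 < lucas n := by
    induction n using Nat.twoStepInduction with
    | zero => decide
    | one => decide
    | more n _ ih => rw [lucas]; omega
  induction n, h using Nat.le_induction with
  | base =>
    obtain ⟨k, rfl⟩ := Nat.exists_eq_add_of_le' hm
    rw [lucas]
    have := pos k
    omega
  | succ n hn ih =>
    obtain ⟨k, rfl⟩ := Nat.exists_eq_add_of_le' (hm.trans (Nat.le_of_succ_le hn))
    rw [lucas]
    have := pos k
    omega

/-- Triples `(M, P, Q)` such that, modulo `M`, the Lucas numbers have period `P` and the repunits
with at least four digits have period `Q`. -/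
def sieveModuli : List (ℕ × ℕ × ℕ) :=
  [(40, 12, 1), (25, 20, 1), (275, 20, 2), (2200, 60, 2),
    (12625, 100, 4), (48, 24, 3), (20336, 120, 15)]

theorem period_of_mem_sieveModuli : ∀ t ∈ sieveModuli,
    0 < t.2.1 ∧ 0 < t.2.2 ∧ lucas t.2.1 % t.1 = lucas 0 % t.1 ∧
      lucas (t.2.1 + 1) % t.1 = lucas 1 % t.1 ∧
      repunit (4 + t.2.2) % t.1 = repunit 4 % t.1 := by
  decide +kernel

theorem exists_mem_sieveModuli : ∀ d₁ ∈ Finset.Icc 1 9, ∀ d₂ < 10, ∀ m ∈ Finset.Icc 1 4,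
    ∃ t ∈ sieveModuli, ∀ r < t.2.2, ∀ s < t.2.1,
      (d₁ * repunit (4 + r) * 10 ^ m + d₂ * repunit m) % t.1 ≠ lucas s % t.1 := by
  decide +kernel

theorem lucas_ne_of_four_le {d₁ d₂ l m : ℕ} (hd₁ : 1 ≤ d₁) (hd₁' : d₁ < 10) (hd₂ : d₂ < 10)
    (hl : 4 ≤ l) (hm : 1 ≤ m) (hm' : m < 5) (n : ℕ) :
    lucas n ≠ d₁ * repunit l * 10 ^ m + d₂ * repunit m := by
  intro h
  obtain ⟨k, rfl⟩ := Nat.exists_eq_add_of_le hl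
  obtain ⟨⟨M, P, Q⟩, ht, hs⟩ := exists_mem_sieveModuli d₁
    (Finset.mem_Icc.2 ⟨hd₁, by omega⟩) d₂ hd₂ m (Finset.mem_Icc.2 ⟨hm, by omega⟩)
  obtain ⟨hP, hQ, h₀, h₁, hr⟩ := period_of_mem_sieveModuli _ ht
  have hrep := repunit_modEq_mod hr k
  refine hs _ (Nat.mod_lt k hQ) _ (Nat.mod_lt n hP) ?_
  have := lucas_modEq_mod h₀ h₁ n
  rw [h] at this
  exact (((hrep.mul_left d₁).mul_right _).add_right _).symm.trans this

theorem eq_nine_of_modEq_repdigit : ∀ d < 10, ∀ s < 48,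
    lucas s % 160 = d * 11111 % 160 → d = 9 ∧ s = 47 := by
  decide +kernel

theorem not_dvd_mul_repunit_add_one : ∀ d < 10, 1 ≤ d → ∀ r < 6,
    (d * repunit r + 1) % 21 ≠ 0 := by
  decide +kernel

theorem lucas_ne_of_five_le {d₁ d₂ m : ℕ} (hd₁ : 1 ≤ d₁) (hd₁' : d₁ < 10) (hd₂ : d₂ < 10)
    (hm : 5 ≤ m) (l n : ℕ) : lucas n ≠ d₁ * repunit l * 10 ^ m + d₂ * repunit m := by
  intro h
  have hd₂n : d₂ = 9 ∧ n % 48 = 47 := by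
    refine eq_nine_of_modEq_repdigit d₂ hd₂ _ (Nat.mod_lt n (by norm_num)) ?_
    have hn : lucas n % 160 = lucas (n % 48) % 160 :=
      lucas_modEq_mod (M := 160) (by decide +kernel) (by decide +kernel) n
    rw [← hn, h]
    obtain ⟨k, rfl⟩ := Nat.exists_eq_add_of_le hm
    rw [repunit_add, show repunit 5 = 11111 from rfl, pow_add,
      show d₁ * repunit l * (10 ^ 5 * 10 ^ k) + d₂ * (10 ^ 5 * repunit k + 11111) =
        d₂ * 11111 + 160 * (625 * (d₁ * repunit l * 10 ^ k + d₂ * repunit k)) by ring,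
      Nat.add_mul_mod_self_left]
  obtain ⟨rfl, hn⟩ := hd₂n
  have hn21 : lucas n % 21 = 20 := by
    have := lucas_modEq_mod (M := 21) (P := 16) (by decide +kernel) (by decide +kernel) n
    rw [show n % 16 = 15 by omega] at this
    exact this
  have hsucc : lucas n + 1 = (d₁ * repunit l + 1) * 10 ^ m := by
    rw [h, ← nine_mul_repunit_add_one m]; ring
  have hdvd : 21 ∣ d₁ * repunit l + 1 := by
    have hcop : Nat.Coprime 21 (10 ^ m) := Nat.Coprime.pow_right m (by norm_num)
    refine hcop.dvd_of_dvd_mul_right (hsucc ▸ ?_)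
    omega
  have hrep := repunit_modEq_mod (M := 21) (Q := 6) (j := 0) (by decide +kernel) l
  simp only [zero_add] at hrep
  refine not_dvd_mul_repunit_add_one d₁ hd₁' hd₁ _ (Nat.mod_lt l (by norm_num)) ?_
  have hmod : (d₁ * repunit l + 1) % 21 = (d₁ * repunit (l % 6) + 1) % 21 :=
    (hrep.mul_left d₁).add_right 1
  omega

theorem lucas_concat_of_lt : ∀ d₁ ∈ Finset.Icc 1 9, ∀ d₂ < 10, ∀ l ∈ Finset.Icc 1 3,
    ∀ m ∈ Finset.Icc 1 4, ∀ n < 35, lucas n = d₁ * repunit l * 10 ^ m + d₂ * repunit m →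
      lucas n ∈ [11, 18, 29, 47, 76, 199, 322] := by
  decide +kernel

theorem lucas_mem_of_eq_concat {d₁ d₂ l m n : ℕ} (hd₁ : 1 ≤ d₁) (hd₁' : d₁ < 10) (hd₂ : d₂ < 10)
    (hl : 1 ≤ l) (hm : 1 ≤ m) (h : lucas n = d₁ * repunit l * 10 ^ m + d₂ * repunit m) :
    lucas n ∈ [11, 18, 29, 47, 76, 199, 322] := by
  have hm' : m < 5 := by
    by_contra! hm'
    exact lucas_ne_of_five_le hd₁ hd₁' hd₂ hm' l n h
  have hl' : l < 4 := by
    by_contra! hl'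
    exact lucas_ne_of_four_le hd₁ hd₁' hd₂ hl' hm hm' n h
  refine lucas_concat_of_lt d₁ (Finset.mem_Icc.2 ⟨hd₁, by omega⟩) d₂ hd₂
    l (Finset.mem_Icc.2 ⟨hl, by omega⟩) m (Finset.mem_Icc.2 ⟨hm, by omega⟩) n ?_ h
  by_contra! hn
  have hbig : 10 ^ 7 < lucas n :=
    lt_of_lt_of_le (by decide +kernel : 10 ^ 7 < lucas 34)
      (lucas_lt_lucas (by norm_num) (show 34 < n by omega)).le
  have hrl : d₁ * repunit l ≤ 9 * 111 :=
    Nat.mul_le_mul (by omega) (by interval_cases l <;> decide)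
  have hrm : d₂ * repunit m ≤ 9 * 1111 :=
    Nat.mul_le_mul (by omega) (by interval_cases m <;> decide)
  have hpow : 10 ^ m ≤ 10 ^ 4 := Nat.pow_le_pow_right (by norm_num) (by omega)
  have := Nat.mul_le_mul hrl hpow
  omega

/-- The only Lucas numbers that are concatenations of two repdigits are
`11, 18, 29, 47, 76, 199, 322`. -/
theorem lucas_concat_two_repdigits :
    {N : ℕ | (∃ n : ℕ, lucas n = N) ∧
      ∃ (d1 d2 : ℤ) (ℓ m : ℕ), 1 ≤ d1 ∧ d1 ≤ 9 ∧ 0 ≤ d2 ∧ d2 ≤ 9 ∧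
        1 ≤ ℓ ∧ 1 ≤ m ∧
        9 * (N : ℤ) = d1 * (10 ^ ℓ - 1) * 10 ^ m + d2 * (10 ^ m - 1)}
    = {11, 18, 29, 47, 76, 199, 322} := by
  ext N
  constructor
  · rintro ⟨⟨n, rfl⟩, d₁, d₂, l, m, hd₁, hd₁', hd₂, hd₂', hl, hm, h⟩
    have hN := concat_repdigits_eq h
    lift d₁ to ℕ using by omega
    lift d₂ to ℕ using hd₂
    norm_cast at hN
    simpa using lucas_mem_of_eq_concat (by omega) (by omega) (by omega) hl hm hN
  · rintro (rfl | rfl | rfl | rfl | rfl | rfl | rfl)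
    · exact ⟨⟨5, rfl⟩, 1, 1, 1, 1, by norm_num⟩
    · exact ⟨⟨6, rfl⟩, 1, 8, 1, 1, by norm_num⟩
    · exact ⟨⟨7, rfl⟩, 2, 9, 1, 1, by norm_num⟩
    · exact ⟨⟨8, rfl⟩, 4, 7, 1, 1, by norm_num⟩
    · exact ⟨⟨9, rfl⟩, 7, 6, 1, 1, by norm_num⟩
    · exact ⟨⟨11, rfl⟩, 1, 9, 1, 2, by norm_num⟩
    · exact ⟨⟨12, rfl⟩, 3, 2, 1, 2, by norm_num⟩
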